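/- For every z ∈ ϱ(H) ∩ ϱ(H_T): A_TĜ_z = 1 on 𝔉; ker(Ĝ_z) = {0}; and ran(Ĝ_z) ∩ dom(H_T) = {0}. -/

import Mathlib

noncomputable section

open scoped ComplexInnerProductSpace
open ContinuousLinearMap Filter

variable {F X : Type*}
  [NormedAddCommGroup F] [InnerProductSpace ℂ F] [CompleteSpace F]
  [NormedAddCommGroup X] [InnerProductSpace ℂ X] [CompleteSpace X]

/-- `W R l z = 1 + (z - l) • R`; the point `z` belongs to the resolvent set of the
self-adjoint operator `H` iff `W R l z` is boundedly invertible, where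
`R = (-H + λ₀)⁻¹` and `l = λ₀ ∈ ϱ(H) ∩ ℝ` encode `H`. -/
def W (R : F →L[ℂ] F) (l : ℝ) (z : ℂ) : F →L[ℂ] F := 1 + (z - (l : ℂ)) • R

/-- The resolvent set `ϱ(H)` of `H`, encoded through `R = (-H + λ₀)⁻¹`. -/
def res (R : F →L[ℂ] F) (l : ℝ) : Set ℂ := {z | IsUnit (W R l z)}

/-- The resolvent `R_z = (-H + z)⁻¹`. -/
def Rz (R : F →L[ℂ] F) (l : ℝ) (z : ℂ) : F →L[ℂ] F := R ∘L Ring.inverse (W R l z)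

/-- `G_z = (Σ R_z̄)*`, where the bounded operator `B = Σ ∘ R : 𝔉 →L 𝔛` encodes the
(graph-norm bounded) operator `Σ : 𝔥₁ → 𝔛`. -/
def Gz (R : F →L[ℂ] F) (B : F →L[ℂ] X) (l : ℝ) (z : ℂ) : X →L[ℂ] F :=
  adjoint (B ∘L Ring.inverse (W R l (starRingEnd ℂ z)))

/-- `(-H + λ₀) ψ`, for `ψ ∈ dom H = ran R`. -/
def Hinv (R : F →L[ℂ] F) (ψ : F) : F := Function.invFun (⇑R) ψ

/-- `Σ ψ`, for `ψ ∈ dom H = ran R`. -/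
def SigmaOf (R : F →L[ℂ] F) (B : F →L[ℂ] X) (ψ : F) : X := B (Hinv R ψ)

/-- `Q` is the resolvent `(-K + z)⁻¹` of the (in general unbounded) operator `K`. -/
def IsResolventAt (K : F →ₗ.[ℂ] F) (z : ℂ) (Q : F →L[ℂ] F) : Prop :=
  (∀ ψ : F, Q ψ ∈ K.domain) ∧
  (∀ (ψ : F) (h : Q ψ ∈ K.domain), z • Q ψ - K ⟨Q ψ, h⟩ = ψ) ∧
  (∀ ψ : K.domain, Q (z • (ψ : F) - K ψ) = (ψ : F))

/-- The resolvent set of the (in general unbounded) operator `K`. -/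
def pres (K : F →ₗ.[ℂ] F) : Set ℂ := {z | ∃ Q : F →L[ℂ] F, IsResolventAt K z Q}

/-- `A_* ψ`: the (for `ψ ∈ dom S^×` unique) `φ` with `ψ - G φ ∈ 𝔥₁ = ran R`. -/
def Astar (R B : F →L[ℂ] F) (l : ℝ) (ψ : F) : F :=
  Classical.epsilon fun φ : F => ψ - Gz R B l l φ ∈ Set.range ⇑R

/-- `Σ̂ ψ = (1 - A_*) ψ`. -/
def SigmaHat (R B : F →L[ℂ] F) (l : ℝ) (ψ : F) : F := ψ - Astar R B l ψ

/-- `A₀ ψ = A ψ₀`, where `ψ₀ = ψ - G (A_* ψ)`. -/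
def Azero (R B : F →L[ℂ] F) (l : ℝ) (ψ : F) : F :=
  B (Hinv R (ψ - Gz R B l l (Astar R B l ψ)))

/-- `S^× ψ = λ₀ ψ - (-H + λ₀) ψ₀`, where `ψ₀ = ψ - G (A_* ψ)`. -/
def SxFun (R B : F →L[ℂ] F) (l : ℝ) (ψ : F) : F :=
  (l : ℂ) • ψ - Hinv R (ψ - Gz R B l l (Astar R B l ψ))

/-- `K ∈ B(𝔉)` is a two-sided bounded inverse of `A_T G_z = T - A (G - G_z)`
(with domain `dom T`). -/
def IsInvATG (R B : F →L[ℂ] F) (l : ℝ) (T : F →ₗ.[ℂ] F) (z : ℂ)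
    (K : F →L[ℂ] F) : Prop :=
  (∀ y : F, K y ∈ T.domain) ∧
  (∀ (y : F) (h : K y ∈ T.domain),
    T ⟨K y, h⟩ - SigmaOf R B ((Gz R B l l - Gz R B l z) (K y)) = y) ∧
  (∀ x : T.domain,
    K (T x - SigmaOf R B ((Gz R B l l - Gz R B l z) (x : F))) = (x : F))

theorem LinearPMap.mem_domain_of_isSelfAdjoint {S : F →ₗ.[ℂ] F} (hS : IsSelfAdjoint S) {y w : F}
    (h : ∀ x : S.domain, ⟪w, (x : F)⟫ = ⟪y, S x⟫) :
    ∃ hy : y ∈ S.domain, S ⟨y, hy⟩ = w := by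
  have key : ∃ hy : y ∈ (LinearPMap.adjoint S).domain, (LinearPMap.adjoint S) ⟨y, hy⟩ = w :=
    ⟨LinearPMap.mem_adjoint_domain_of_exists y ⟨w, h⟩,
      LinearPMap.adjoint_apply_eq hS.dense_domain _ h⟩
  rwa [LinearPMap.isSelfAdjoint_def.mp hS] at key

theorem LinearPMap.inner_map_eq_of_isSelfAdjoint {S : F →ₗ.[ℂ] F} (hS : IsSelfAdjoint S)
    (x y : S.domain) : ⟪S x, (y : F)⟫ = ⟪(x : F), S y⟫ := by
  have h := LinearPMap.adjoint_isFormalAdjoint (T := S) hS.dense_domain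
  rw [LinearPMap.isSelfAdjoint_def.mp hS] at h
  exact h x y

theorem adjoint_W {R : F →L[ℂ] F} (hR : IsSelfAdjoint R) (l : ℝ) (z : ℂ) :
    star (W R l z) = W R l (starRingEnd ℂ z) := by
  simp [W, hR.star_eq]

theorem conj_mem_res {R : F →L[ℂ] F} (hR : IsSelfAdjoint R) {l : ℝ} {z : ℂ} (hz : z ∈ res R l) :
    starRingEnd ℂ z ∈ res R l := by
  have h : IsUnit (W R l z) := hz
  change IsUnit (W R l (starRingEnd ℂ z))
  rw [← adjoint_W hR]
  exact h.star

theorem adjoint_inverse_W {R : F →L[ℂ] F} (hR : IsSelfAdjoint R) (l : ℝ) (z : ℂ) :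
    adjoint (Ring.inverse (W R l z)) = Ring.inverse (W R l (starRingEnd ℂ z)) := by
  rw [← star_eq_adjoint, ← Ring.inverse_star, adjoint_W hR]

theorem commute_inverse_W {E : Type*} [NormedAddCommGroup E] [InnerProductSpace ℂ E]
    {R : E →L[ℂ] E} {l : ℝ} {z : ℂ} (hz : z ∈ res R l) :
    Commute R (Ring.inverse (W R l z)) := by
  have h : Commute R (W R l z) := (Commute.one_right R).add_right ((Commute.refl R).smul_right _)
  obtain ⟨u, hu⟩ := hz
  rw [← hu] at h ⊢
  rw [Ring.inverse_unit]
  exact h.units_inv_right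

theorem Gz_eq {R : F →L[ℂ] F} (hR : IsSelfAdjoint R) (B : F →L[ℂ] X) (l : ℝ) (z : ℂ) :
    Gz R B l z = Ring.inverse (W R l z) ∘L adjoint B := by
  rw [Gz, adjoint_comp, adjoint_inverse_W hR, Complex.conj_conj]

theorem Gz_self (R : F →L[ℂ] F) (B : F →L[ℂ] X) (l : ℝ) : Gz R B l l = adjoint B := by
  have h : W R l (starRingEnd ℂ (l : ℂ)) = 1 := by simp [W]
  rw [Gz, h, Ring.inverse_one]
  rfl

theorem adjoint_Gz_conj (R : F →L[ℂ] F) (B : F →L[ℂ] X) (l : ℝ) (z : ℂ) :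
    adjoint (Gz R B l (starRingEnd ℂ z)) = B ∘L Ring.inverse (W R l z) := by
  rw [Gz, adjoint_adjoint, Complex.conj_conj]

theorem adjoint_Gz (R : F →L[ℂ] F) (B : F →L[ℂ] X) (l : ℝ) (z : ℂ) :
    adjoint (Gz R B l z) = B ∘L Ring.inverse (W R l (starRingEnd ℂ z)) := by
  rw [Gz, adjoint_adjoint]

theorem Gz_sub_apply {R : F →L[ℂ] F} (hR : IsSelfAdjoint R) (B : F →L[ℂ] X) {l : ℝ} {z : ℂ}
    (hz : z ∈ res R l) (x : X) :
    Gz R B l l x - Gz R B l z x = R ((z - (l : ℂ)) • Gz R B l z x) := by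
  have h : W R l z (Gz R B l z x) = Gz R B l l x := by
    rw [Gz_self, Gz_eq hR]
    exact DFunLike.congr_fun (Ring.mul_inverse_cancel _ hz) _
  rw [← h, map_smul]
  simp [W]

theorem Hinv_apply {E : Type*} [NormedAddCommGroup E] [InnerProductSpace ℂ E] {R : E →L[ℂ] E}
    (hinj : Function.Injective R) (x : E) : Hinv R (R x) = x :=
  Function.leftInverse_invFun hinj x

theorem SigmaOf_Gz_sub {R : F →L[ℂ] F} (hR : IsSelfAdjoint R) (hinj : Function.Injective R)
    (B : F →L[ℂ] X) {l : ℝ} {z : ℂ} (hz : z ∈ res R l) (x : X) :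
    SigmaOf R B ((Gz R B l l - Gz R B l z) x) = ((z - (l : ℂ)) • (B ∘L Gz R B l z)) x := by
  rw [_root_.sub_apply, Gz_sub_apply hR B hz, SigmaOf, Hinv_apply hinj]
  simp

theorem adjoint_smul_comp_Gz {R : F →L[ℂ] F} (hR : IsSelfAdjoint R) (B : F →L[ℂ] X) (l : ℝ)
    (z : ℂ) :
    adjoint ((z - (l : ℂ)) • (B ∘L Gz R B l z)) =
      (starRingEnd ℂ z - (l : ℂ)) • (B ∘L Gz R B l (starRingEnd ℂ z)) := by
  rw [map_smulₛₗ, adjoint_comp, adjoint_Gz, Gz_eq hR B l (starRingEnd ℂ z)]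
  simp [ContinuousLinearMap.comp_assoc]

theorem IsInvATG.adjoint {R B : F →L[ℂ] F} (hR : IsSelfAdjoint R) (hinj : Function.Injective R)
    {l : ℝ} {T : F →ₗ.[ℂ] F} (hT : IsSelfAdjoint T) {z : ℂ} (hz : z ∈ res R l) {K : F →L[ℂ] F}
    (hK : IsInvATG R B l T z K) :
    IsInvATG R B l T (starRingEnd ℂ z) (ContinuousLinearMap.adjoint K) := by
  obtain ⟨hmem, hright, hleft⟩ := hK
  simp only [SigmaOf_Gz_sub hR hinj B hz] at hright hleft
  have hz' := conj_mem_res hR hz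
  set C := (z - (l : ℂ)) • (B ∘L Gz R B l z) with hC
  have hC' := adjoint_smul_comp_Gz hR B l z
  rw [← hC] at hC'
  have key (y : F) : ∃ h : ContinuousLinearMap.adjoint K y ∈ T.domain,
      T ⟨_, h⟩ = y + ContinuousLinearMap.adjoint C (ContinuousLinearMap.adjoint K y) := by
    refine LinearPMap.mem_domain_of_isSelfAdjoint hT fun x => ?_
    rw [inner_add_left, adjoint_inner_left, adjoint_inner_left, adjoint_inner_left]
    have h := hleft x
    rw [map_sub, sub_eq_iff_eq_add] at h
    rw [h, inner_add_right]
  refine ⟨fun y => (key y).1, fun y h => ?_, fun x => ?_⟩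
  · rw [SigmaOf_Gz_sub hR hinj B hz', ← hC', (key y).2]
    simp
  · rw [SigmaOf_Gz_sub hR hinj B hz', ← hC']
    refine ext_inner_right ℂ fun y => ?_
    rw [adjoint_inner_left, inner_sub_left, adjoint_inner_left,
      LinearPMap.inner_map_eq_of_isSelfAdjoint hT x ⟨K y, hmem y⟩, ← inner_sub_right,
      hright]

theorem Astar_eq {R B : F →L[ℂ] F} {l : ℝ} (hkerG : Function.Injective (Gz R B l l))
    (hranG : Set.range ⇑(Gz R B l l) ∩ Set.range ⇑R = {0}) {ψ φ : F}
    (h : ψ - Gz R B l l φ ∈ Set.range R) : Astar R B l ψ = φ := by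
  have hε : ψ - Gz R B l l (Astar R B l ψ) ∈ Set.range R :=
    Classical.epsilon_spec (p := fun φ : F => ψ - Gz R B l l φ ∈ Set.range ⇑R) ⟨φ, h⟩
  obtain ⟨a, ha⟩ := h
  obtain ⟨b, hb⟩ := hε
  have h0 : Gz R B l l (Astar R B l ψ - φ) ∈ ({0} : Set F) := by
    rw [← hranG]
    exact ⟨⟨_, rfl⟩, a - b, by rw [map_sub, map_sub, ha, hb]; abel⟩
  exact sub_eq_zero.mp (hkerG (h0.trans (map_zero _).symm))

/-- For every `z ∈ ϱ(H) ∩ ϱ(H_T)`: `A_T Ĝ_z = 1` on `𝔉`,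
`ker Ĝ_z = {0}` and `ran Ĝ_z ∩ dom H_T = {0}`.
(Here `A_T ξ = A₀ ξ + T (A_* ξ)` for `ξ ∈ dom S^×` with `A_* ξ ∈ dom T`.) -/
theorem statement13
    (R B : F →L[ℂ] F) (l : ℝ)
    (hR : IsSelfAdjoint R) (hinj : Function.Injective ⇑R)
    (hkerG : Function.Injective ⇑(Gz R B l l))
    (hranG : Set.range ⇑(Gz R B l l) ∩ Set.range ⇑R = {0})
    (T : F →ₗ.[ℂ] F) (hT : IsSelfAdjoint T)
    (HT : F →ₗ.[ℂ] F) (hHTsa : IsSelfAdjoint HT)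
    (hHTdom : (HT.domain : Set F)
      = {ψ | ∃ (φ : F) (h : ψ - Gz R B l l φ ∈ Set.range ⇑R) (hφ : φ ∈ T.domain),
          SigmaOf R B (ψ - Gz R B l l φ) + T ⟨φ, hφ⟩ = 0})
    (hHTact : ∀ (ψ : HT.domain) (φ : F),
      (ψ : F) - Gz R B l l φ ∈ Set.range ⇑R →
      HT ψ = (l : ℂ) • (ψ : F) - Hinv R ((ψ : F) - Gz R B l l φ))
    (hZeq : ∀ z : ℂ, z ∈ res R l ∩ pres HT ↔
      (z ∈ res R l ∧ ∃ K : F →L[ℂ] F, IsInvATG R B l T z K))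
    (hZne : (res R l ∩ pres HT).Nonempty)
    (hHTres : ∀ z ∈ res R l ∩ pres HT, ∀ K : F →L[ℂ] F, IsInvATG R B l T z K →
      IsResolventAt HT z
        (Rz R l z - Gz R B l z ∘L K ∘L adjoint (Gz R B l (starRingEnd ℂ z))))
    (Ghat : ℂ → F →L[ℂ] F)
    (hGhat : ∀ z ∈ pres HT, ∀ Q : F →L[ℂ] F,
      IsResolventAt HT (starRingEnd ℂ z) Q →
      ∀ φ ψ : F, ⟪Ghat z φ, ψ⟫ = ⟪φ, SigmaHat R B l (Q ψ)⟫)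
    (z : ℂ) (hz : z ∈ res R l ∩ pres HT) :
    (∀ φ : F, ∃ hA : Astar R B l (Ghat z φ) ∈ T.domain,
      Azero R B l (Ghat z φ) + T ⟨Astar R B l (Ghat z φ), hA⟩ = φ) ∧
    Function.Injective ⇑(Ghat z) ∧
    Set.range ⇑(Ghat z) ∩ (HT.domain : Set F) = {0} := by
  obtain ⟨hzr, K, hK⟩ := (hZeq z).mp hz
  have hK' := hK.adjoint hR hinj hT hzr
  have hzr' := conj_mem_res hR hzr
  have hQ' := hHTres _ ((hZeq _).mpr ⟨hzr', _, hK'⟩) _ hK'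
  have hform (φ : F) : Ghat z φ = R (Ring.inverse (W R l z) φ) +
      Gz R B l z (K (φ - B (Ring.inverse (W R l z) φ))) := by
    refine ext_inner_right ℂ fun ψ => ?_
    rw [hGhat z hz.2 _ hQ']
    have hA : Astar R B l ((Rz R l (starRingEnd ℂ z) - Gz R B l (starRingEnd ℂ z) ∘L adjoint K ∘L
        adjoint (Gz R B l (starRingEnd ℂ (starRingEnd ℂ z)))) ψ) =
        -(adjoint K (adjoint (Gz R B l z) ψ)) := by
      refine Astar_eq hkerG hranG ⟨Ring.inverse (W R l (starRingEnd ℂ z)) ψ +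
        (starRingEnd ℂ z - (l : ℂ)) • Gz R B l (starRingEnd ℂ z)
          (adjoint K (adjoint (Gz R B l z) ψ)), ?_⟩
      rw [map_add, ← Gz_sub_apply hR B hzr']
      simp only [Rz, Complex.conj_conj, _root_.sub_apply,
        ContinuousLinearMap.comp_apply, map_neg]
      abel
    rw [SigmaHat, hA]
    have hcomm : R (Ring.inverse (W R l z) φ) = Ring.inverse (W R l z) (R φ) :=
      DFunLike.congr_fun (commute_inverse_W hzr).eq φ
    have hRadj : adjoint R = R := hR
    have hGadj : B (Ring.inverse (W R l z) φ) = adjoint (Gz R B l (starRingEnd ℂ z)) φ := by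
      rw [adjoint_Gz_conj]; rfl
    rw [hGadj, hcomm, ← Complex.conj_conj z, ← adjoint_inverse_W hR, Complex.conj_conj]
    simp only [Rz, Complex.conj_conj, _root_.sub_apply,
      ContinuousLinearMap.comp_apply, sub_neg_eq_add, inner_add_left, inner_add_right,
      inner_sub_right, map_sub, inner_sub_left, adjoint_inner_left, adjoint_inner_right]
    rw [← adjoint_inner_left (Gz R B l (starRingEnd ℂ z)), adjoint_inner_right K,
      adjoint_inner_right (Gz R B l z), ← adjoint_inner_left R, hRadj]
    ring
  have hsub (φ : F) : Ghat z φ - Gz R B l l (K (φ - B (Ring.inverse (W R l z) φ))) =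
      R (Ring.inverse (W R l z) φ - (z - (l : ℂ)) •
        Gz R B l z (K (φ - B (Ring.inverse (W R l z) φ)))) := by
    rw [map_sub R, ← Gz_sub_apply hR B hzr, hform]
    abel
  have hstar (φ : F) : Astar R B l (Ghat z φ) = K (φ - B (Ring.inverse (W R l z) φ)) :=
    Astar_eq hkerG hranG ⟨_, (hsub φ).symm⟩
  have hone (φ : F) : ∃ hA : Astar R B l (Ghat z φ) ∈ T.domain,
      Azero R B l (Ghat z φ) + T ⟨Astar R B l (Ghat z φ), hA⟩ = φ := by
    simp only [Azero, hstar, hsub, Hinv_apply hinj]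
    refine ⟨hK.1 _, ?_⟩
    have h := hK.2.1 _ (hK.1 (φ - B (Ring.inverse (W R l z) φ)))
    rw [SigmaOf_Gz_sub hR hinj B hzr, sub_eq_iff_eq_add] at h
    rw [h]
    simp
  refine ⟨hone, fun φ₁ φ₂ h => ?_, Set.eq_singleton_iff_unique_mem.mpr
    ⟨⟨⟨0, map_zero _⟩, HT.domain.zero_mem⟩, ?_⟩⟩
  · obtain ⟨_, h₁⟩ := hone φ₁
    obtain ⟨_, h₂⟩ := hone φ₂
    rw [← h₁, ← h₂]
    simp only [h]
  · rintro _ ⟨⟨φ, rfl⟩, hdom⟩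
    rw [hHTdom] at hdom
    obtain ⟨χ, hχ, hχT, h0⟩ := hdom
    obtain ⟨_, h₁⟩ := hone φ
    have hφ : φ = 0 := by
      rw [← h₁, ← h0]
      simp only [Azero, SigmaOf, Astar_eq hkerG hranG hχ]
    rw [hφ, map_zero]
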